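/- arXiv:1712.09861 — 2 statements merged into one kernel-verified Lean document; each statement's English description precedes it below -/
import Mathlib

section
/- Let q be a power of an odd prime p, write n = p^k u with gcd(u, p) = 1, and let q' be the largest squarefree divisor of q^n − 1. Let p_1, …, p_s be distinct primes dividing q' (possibly s = 0) such that δ := 1 − Σ_{i=1}^s 1/p_i > 0, and set q_0 := q'/(p_1 ⋯ p_s). If q^{n/2} > 2 · W(q_0) · W(x^u − 1) · ((s − 1)/δ + 2), then there exists an element of F_{q^n} that is simultaneously 2-primitive and normal over F_q. -/
open Polynomial

/-- The `F_q`-span of the conjugates `α, α^q, …, α^{q^{n-1}}` of `α ∈ F_{q^n}`. -/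
def conjSpan (K : Type*) {L : Type*} [Field K] [Field L] [Algebra K L]
    (q n : ℕ) (α : L) : Submodule K L :=
  Submodule.span K (Set.range fun i : Fin n => α ^ q ^ (i : ℕ))

/-- `W(t) = 2^{ω(t)}`, the number of squarefree divisors of the positive integer `t`. -/
def Wnat (t : ℕ) : ℕ := 2 ^ t.primeFactors.card

/-- `W(f)`, the number of monic squarefree divisors of `f` in `F_q[x]`. -/
noncomputable def Wpoly {K : Type*} [Field K] (f : Polynomial K) : ℕ :=
  Set.ncard {d : Polynomial K | d.Monic ∧ Squarefree d ∧ d ∣ f}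

section CharacterSums

variable {F : Type*} [Field F] [Fintype F]

/-- A Gauss sum with nontrivial additive character is bounded by the square root of the
cardinality of the field. -/
lemma norm_gaussSum_le_sqrt (χ : MulChar F ℂ) {ψ : AddChar F ℂ} (hψ : ψ ≠ 1) :
    ‖gaussSum χ ψ‖ ≤ √(Fintype.card F) := by
  by_cases hχ : χ = 1
  · subst hχ
    rw [gaussSum_one_left hψ, norm_neg, norm_one]
    exact Real.one_le_sqrt.mpr (by exact_mod_cast Fintype.card_pos)
  · have h := gaussSum_mul_gaussSum_eq_card hχ (AddChar.IsPrimitive.of_ne_one hψ)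
    rw [← star_gaussSum_eq, ← starRingEnd_apply, Complex.mul_conj'] at h
    exact Real.le_sqrt_of_sq_le (le_of_eq (by exact_mod_cast h))

/-- A multiplicative character of a finite field of odd characteristic that is even is the
square of a multiplicative character. -/
lemma MulChar.exists_sq_eq_of_apply_neg_one (hF : ringChar F ≠ 2) {χ : MulChar F ℂ}
    (h : χ (-1) = 1) : ∃ ω : MulChar F ℂ, ∀ y, ω (y ^ 2) = χ y := by
  classical
  obtain ⟨g, hg⟩ := IsCyclic.exists_generator (α := Fˣ)
  obtain ⟨z, hz⟩ := IsAlgClosed.exists_pow_nat_eq (χ g) (n := 2) (by norm_num)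
  have hz0 : z ≠ 0 := by
    rintro rfl
    exact (g.isUnit.map χ).ne_zero (by rw [← hz]; norm_num)
  have hgneg : (g : F) ^ (Fintype.card F / 2) = -1 := by
    rcases FiniteField.pow_dichotomy hF g.ne_zero with h1 | h1
    · exfalso
      have h2 : g ^ (Fintype.card F / 2) = 1 := Units.ext (by simpa using h1)
      have h3 := orderOf_dvd_of_pow_eq_one h2
      rw [orderOf_eq_card_of_forall_mem_zpowers hg, Nat.card_eq_fintype_card,
        Fintype.card_units] at h3
      have h4 := FiniteField.odd_card_of_char_ne_two hF
      have h5 := Fintype.one_lt_card (α := F)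
      have := Nat.le_of_dvd (by omega) h3
      omega
    · exact h1
  have hroot : Units.mk0 z hz0 ∈ rootsOfUnity (Fintype.card Fˣ) ℂ := by
    rw [mem_rootsOfUnity]
    ext
    have h4 := FiniteField.odd_card_of_char_ne_two hF
    have h5 : Fintype.card Fˣ = 2 * (Fintype.card F / 2) := by
      rw [Fintype.card_units]; omega
    rw [h5]
    push_cast
    rw [Units.val_mk0, pow_mul, hz, ← map_pow, hgneg, h]
  refine ⟨MulChar.ofRootOfUnity hroot hg, fun y => ?_⟩
  have : MulChar.ofRootOfUnity hroot hg ^ 2 = χ := by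
    rw [MulChar.eq_iff hg, MulChar.pow_apply_coe, MulChar.ofRootOfUnity_spec]
    exact hz
  rw [map_pow, ← MulChar.pow_apply' _ two_ne_zero, this]

/-- The Weil bound for a multiplicative character twisted by an additive character
of a square. -/
lemma norm_sum_mulChar_mul_addChar_sq_le (hF : ringChar F ≠ 2) (χ : MulChar F ℂ)
    {ψ : AddChar F ℂ} (hψ : ψ ≠ 1) :
    ‖∑ y, χ y * ψ (y ^ 2)‖ ≤ 2 * √(Fintype.card F) := by
  classical
  by_cases h : χ (-1) = 1
  · obtain ⟨ω, hω⟩ := MulChar.exists_sq_eq_of_apply_neg_one hF h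
    set η : MulChar F ℂ := (quadraticChar F).ringHomComp (Int.castRingHom ℂ)
    have hsum : ∑ y, χ y * ψ (y ^ 2) = gaussSum ω ψ + gaussSum (η * ω) ψ := by
      calc ∑ y, χ y * ψ (y ^ 2) = ∑ y, ω (y ^ 2) * ψ (y ^ 2) := by simp_rw [hω]
        _ = ∑ z, ∑ y with y ^ 2 = z, ω (y ^ 2) * ψ (y ^ 2) :=
          (Finset.sum_fiberwise _ _ _).symm
        _ = ∑ z, (η z + 1) * (ω z * ψ z) := by
          refine Finset.sum_congr rfl fun z _ => ?_
          rw [Finset.sum_congr rfl (g := fun _ => ω z * ψ z)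
            (by intro y hy; rw [(Finset.mem_filter.mp hy).2]), Finset.sum_const, nsmul_eq_mul]
          congr 1
          have := quadraticChar_card_sqrts hF z
          rw [Set.toFinset_ofPred] at this
          simp only [η, MulChar.ringHomComp_apply, eq_intCast]
          exact_mod_cast this
        _ = _ := by
          simp only [gaussSum, ← Finset.sum_add_distrib]
          refine Finset.sum_congr rfl fun z _ => ?_
          rw [MulChar.mul_apply]; ring
    rw [hsum, two_mul]
    exact (norm_add_le _ _).trans
      (add_le_add (norm_gaussSum_le_sqrt _ hψ) (norm_gaussSum_le_sqrt _ hψ))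
  · have hneg : ∑ y, χ y * ψ (y ^ 2) = χ (-1) * ∑ y, χ y * ψ (y ^ 2) := by
      conv_lhs => rw [← Equiv.sum_comp (Equiv.neg F)]
      rw [Finset.mul_sum]
      refine Finset.sum_congr rfl fun y _ => ?_
      rw [Equiv.neg_apply, neg_sq, ← neg_one_mul, map_mul, mul_assoc]
    have : ∑ y, χ y * ψ (y ^ 2) = 0 := by
      by_contra h0
      exact h (mul_right_cancel₀ h0 (by rw [one_mul]; exact hneg.symm))
    rw [this, norm_zero]
    positivity

end CharacterSums

section AverageDeviation

/-- The deviation of the average of a family of complex numbers from `1`. -/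
noncomputable def avgDev {ι : Type*} (J : Finset ι) (c : ι → ℂ) : ℂ :=
  1 - (∑ j ∈ J, c j) / J.card

lemma avgDev_eq_zero {ι : Type*} {J : Finset ι} {c : ι → ℂ} (hJ : J.Nonempty)
    (h : ∀ j ∈ J, c j = 1) : avgDev J c = 0 := by
  have : (J.card : ℂ) ≠ 0 := by exact_mod_cast hJ.card_pos.ne'
  rw [avgDev, Finset.sum_congr rfl h]
  simp [this]

lemma avgDev_of_sum_eq_neg_one {ι : Type*} {J : Finset ι} {c : ι → ℂ}
    (h : ∑ j ∈ J, c j = -1) : avgDev J c = 1 + 1 / J.card := by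
  rw [avgDev, h]
  ring

lemma norm_average_le {ι : Type*} {J : Finset ι} {c : ι → ℂ} {B : ℝ} (hB : 0 ≤ B)
    (h : ∀ j ∈ J, ‖c j‖ ≤ B) : ‖(∑ j ∈ J, c j) / J.card‖ ≤ B := by
  rcases J.eq_empty_or_nonempty with rfl | hJ
  · simpa using hB
  · have : (0 : ℝ) < J.card := by exact_mod_cast hJ.card_pos
    rw [norm_div, Complex.norm_natCast, div_le_iff₀ this, mul_comm, ← nsmul_eq_mul]
    exact (norm_sum_le _ _).trans (Finset.sum_le_card_nsmul _ _ _ h)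

lemma sum_mul_avgDev {ι α : Type*} (s : Finset α) (J : Finset ι) (f : α → ℂ) (c : ι → α → ℂ) :
    ∑ y ∈ s, f y * avgDev J (fun j => c j y) =
      ∑ y ∈ s, f y - (∑ j ∈ J, ∑ y ∈ s, f y * c j y) / J.card := by
  simp only [avgDev, mul_sub, mul_one, Finset.sum_sub_distrib]
  rw [Finset.sum_comm, Finset.sum_div]
  congr 1
  refine Finset.sum_congr rfl fun y _ => ?_
  rw [← Finset.mul_sum, mul_div_assoc]

lemma norm_sum_mul_avgDev_le {ι α : Type*} {s : Finset α} {J : Finset ι} {f : α → ℂ}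
    {c : ι → α → ℂ} {B : ℝ} (hf : ‖∑ y ∈ s, f y‖ ≤ B)
    (hc : ∀ j ∈ J, ‖∑ y ∈ s, f y * c j y‖ ≤ B) :
    ‖∑ y ∈ s, f y * avgDev J (fun j => c j y)‖ ≤ 2 * B := by
  rw [sum_mul_avgDev, two_mul]
  exact (norm_sub_le _ _).trans
    (add_le_add hf (norm_average_le ((norm_nonneg _).trans hf) hc))

end AverageDeviation

section MultiplicativeSieve

variable {F : Type*} [Field F]

/-- The product over `ℓ ∈ S` of the deviations of the average of the nontrivial powers of the
character `χ ℓ` of order `ℓ`; up to a constant, it detects the elements which are not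
`ℓ`-th powers for any `ℓ ∈ S`. -/
noncomputable def mulSieve (χ : ℕ → MulChar F ℂ) (S : Finset ℕ) (y : F) : ℂ :=
  ∏ ℓ ∈ S, avgDev (Finset.Ico 1 ℓ) (fun j => (χ ℓ ^ j) y)

lemma mulSieve_insert (χ : ℕ → MulChar F ℂ) {S : Finset ℕ} {ℓ : ℕ} (h : ℓ ∉ S) (y : F) :
    mulSieve χ (insert ℓ S) y =
      mulSieve χ S y * avgDev (Finset.Ico 1 ℓ) (fun j => (χ ℓ ^ j) y) := by
  rw [mulSieve, Finset.prod_insert h, mul_comm, mulSieve]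

lemma mulChar_pow_prod_ne_one {χ : ℕ → MulChar F ℂ} {S : Finset ℕ} {ℓ j : ℕ}
    (hS : ∀ r ∈ S, r.Prime) (hℓ : ℓ.Prime) (hχ : orderOf (χ ℓ) = ℓ) (hℓS : ℓ ∉ S)
    (hj : j ∈ Finset.Ico 1 ℓ) : (χ ℓ ^ j) ^ (∏ r ∈ S, r) ≠ 1 := by
  intro h
  rw [← pow_mul] at h
  have h1 := orderOf_dvd_of_pow_eq_one h
  rw [hχ] at h1
  rcases hℓ.dvd_mul.mp h1 with h2 | h2
  · have := Nat.le_of_dvd (Finset.mem_Ico.mp hj).1 h2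
    have := (Finset.mem_Ico.mp hj).2
    omega
  · obtain ⟨r, hr, hd⟩ := (Prime.dvd_finsetProd_iff hℓ.prime _).mp h2
    exact hℓS (((Nat.prime_dvd_prime_iff_eq hℓ (hS r hr)).mp hd) ▸ hr)

variable [Fintype F]

lemma norm_sum_mulChar_mul_mulSieve_le (χ : ℕ → MulChar F ℂ) (S : Finset ℕ) {w : F → ℂ} {B : ℝ}
    (hB : ∀ ω : MulChar F ℂ, ‖∑ y, ω y * w y‖ ≤ B) (ω : MulChar F ℂ) :
    ‖∑ y, ω y * mulSieve χ S y * w y‖ ≤ 2 ^ S.card * B := by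
  induction S using Finset.induction_on generalizing ω with
  | empty => simpa [mulSieve] using hB ω
  | insert ℓ S hℓ ih =>
    rw [Finset.card_insert_of_notMem hℓ, pow_succ', mul_assoc]
    convert norm_sum_mul_avgDev_le (s := Finset.univ) (J := Finset.Ico 1 ℓ)
      (c := fun j y => (χ ℓ ^ j) y) (ih ω) (fun j _ => ?_) using 3 with y
    · rw [mulSieve_insert χ hℓ]; ring
    · convert ih (ω * χ ℓ ^ j) using 3 with y
      rw [MulChar.mul_apply]; ring

lemma sum_mulChar_mul_mulSieve_eq_zero {χ : ℕ → MulChar F ℂ} {S : Finset ℕ}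
    (hχ : ∀ ℓ ∈ S, χ ℓ ^ ℓ = 1) {ω : MulChar F ℂ} (hω : ω ^ (∏ ℓ ∈ S, ℓ) ≠ 1) :
    ∑ y, ω y * mulSieve χ S y = 0 := by
  induction S using Finset.induction_on generalizing ω with
  | empty =>
    simp only [Finset.prod_empty, pow_one] at hω
    simpa [mulSieve] using MulChar.sum_eq_zero_of_ne_one hω
  | insert ℓ S hℓ ih =>
    rw [Finset.prod_insert hℓ] at hω
    have hS : ∀ r ∈ S, χ r ^ r = 1 := fun r hr => hχ r (Finset.mem_insert_of_mem hr)
    simp only [mulSieve_insert χ hℓ, ← mul_assoc]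
    rw [sum_mul_avgDev, ih hS, Finset.sum_eq_zero]
    · simp
    · intro j _
      have : ∑ y, (ω * χ ℓ ^ j) y * mulSieve χ S y = 0 := by
        refine ih hS fun h => hω ?_
        have h1 : (ω * χ ℓ ^ j) ^ ((∏ r ∈ S, r) * ℓ) = 1 := by rw [pow_mul, h, one_pow]
        rw [mul_pow, ← pow_mul, show j * ((∏ r ∈ S, r) * ℓ) = ℓ * (j * ∏ r ∈ S, r) by ring,
          pow_mul (χ ℓ), hχ ℓ (Finset.mem_insert_self _ _), one_pow, mul_one] at h1
        rw [mul_comm]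
        exact h1
      rw [← this]
      refine Finset.sum_congr rfl fun y _ => ?_
      rw [MulChar.mul_apply]; ring
    · exact fun h => hω (by rw [mul_comm, pow_mul, h, one_pow])

lemma sum_one_mul_mulSieve {χ : ℕ → MulChar F ℂ} {S : Finset ℕ} (hS : ∀ ℓ ∈ S, ℓ.Prime)
    (hχ : ∀ ℓ ∈ S, orderOf (χ ℓ) = ℓ) :
    ∑ y, (1 : MulChar F ℂ) y * mulSieve χ S y = (Fintype.card F : ℂ) - 1 := by
  classical
  induction S using Finset.induction_on with
  | empty =>
    simp only [mulSieve, Finset.prod_empty, mul_one]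
    rw [MulChar.sum_one_eq_card_units, Fintype.card_units, Nat.cast_sub Fintype.card_pos,
      Nat.cast_one]
  | insert ℓ S hℓ ih =>
    rw [Finset.forall_mem_insert] at hS hχ
    simp only [mulSieve_insert χ hℓ, ← mul_assoc]
    rw [sum_mul_avgDev, ih hS.2 hχ.2, Finset.sum_eq_zero]
    · simp
    · intro j hj
      rw [← sum_mulChar_mul_mulSieve_eq_zero (S := S) (ω := χ ℓ ^ j)
        (fun r hr => by simpa only [hχ.2 r hr] using pow_orderOf_eq_one (χ r))
        (mulChar_pow_prod_ne_one hS.2 hS.1 hχ.1 hℓ hj)]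
      refine Finset.sum_congr rfl fun y _ => ?_
      rw [mul_right_comm, ← MulChar.mul_apply, one_mul]

end MultiplicativeSieve

section AdditiveSieve

variable {K L : Type*} [Field K] [Field L] [Algebra K L]

/-- The additive character `ψ` is trivial on the image of `f(σ)`. -/
def AddChar.KilledBy (σ : Module.End K L) (f : K[X]) (ψ : AddChar L ℂ) : Prop :=
  ∀ x, ψ (aeval σ f x) = 1

lemma AddChar.KilledBy.mul_right {σ : Module.End K L} {f : K[X]} {ψ : AddChar L ℂ}
    (h : ψ.KilledBy σ f) (g : K[X]) : ψ.KilledBy σ (f * g) := fun x => by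
  rw [map_mul, Module.End.mul_apply]
  exact h _

lemma AddChar.KilledBy.mul_left {σ : Module.End K L} {f : K[X]} {ψ : AddChar L ℂ}
    (h : ψ.KilledBy σ f) (g : K[X]) : ψ.KilledBy σ (g * f) :=
  mul_comm f g ▸ h.mul_right g

lemma AddChar.KilledBy.eq_one_of_isCoprime {σ : Module.End K L} {f g : K[X]} {ψ : AddChar L ℂ}
    (hf : ψ.KilledBy σ f) (hg : ψ.KilledBy σ g) (h : IsCoprime f g) : ψ = 1 := by
  obtain ⟨a, b, hab⟩ := h
  ext x
  have h1 : x = aeval σ (a * f) x + aeval σ (b * g) x := by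
    rw [← LinearMap.add_apply, ← map_add, hab, map_one, Module.End.one_apply]
  rw [h1, AddChar.map_add_eq_mul, hf.mul_left a, hg.mul_left b, AddChar.one_apply, one_mul]

variable [Fintype L]

open Classical in
/-- The nontrivial additive characters that are trivial on the image of `f(σ)`. -/
noncomputable def killedChars (σ : Module.End K L) (f : K[X]) : Finset (AddChar L ℂ) :=
  {ψ | ψ ≠ 1 ∧ ψ.KilledBy σ f}

lemma mem_killedChars {σ : Module.End K L} {f : K[X]} {ψ : AddChar L ℂ} :
    ψ ∈ killedChars σ f ↔ ψ ≠ 1 ∧ ψ.KilledBy σ f := by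
  simp [killedChars]

/-- The product over `f ∈ T` of the deviations of the average of the nontrivial characters
killed by `f`; up to a constant, it detects the elements which are not in the image of `f(σ)`
for any `f ∈ T`. -/
noncomputable def addSieve (σ : Module.End K L) (T : Finset K[X]) (x : L) : ℂ :=
  ∏ f ∈ T, avgDev (killedChars σ f) (fun ψ => ψ x)

open Classical in
lemma addSieve_insert (σ : Module.End K L) {T : Finset K[X]} {f : K[X]} (h : f ∉ T) (x : L) :
    addSieve σ (insert f T) x = addSieve σ T x * avgDev (killedChars σ f) (fun ψ => ψ x) := by
  rw [addSieve, Finset.prod_insert h, mul_comm, addSieve]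

lemma norm_sum_addChar_mul_addSieve_le (σ : Module.End K L) (T : Finset K[X]) {φ : L → ℂ}
    {v : L → L} {B : ℝ} (hB : ∀ ψ : AddChar L ℂ, ψ ≠ 1 → ‖∑ y, φ y * ψ (v y)‖ ≤ B)
    {ψ : AddChar L ℂ} (hψ : ¬ ψ.KilledBy σ (∏ f ∈ T, f)) :
    ‖∑ y, φ y * ψ (v y) * addSieve σ T (v y)‖ ≤ 2 ^ T.card * B := by
  classical
  induction T using Finset.induction_on generalizing ψ with
  | empty =>
    simp only [addSieve, Finset.prod_empty, mul_one, Finset.card_empty, pow_zero, one_mul]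
    refine hB ψ ?_
    rintro rfl
    exact hψ fun x => AddChar.one_apply _
  | insert f T hf ih =>
    rw [Finset.prod_insert hf] at hψ
    rw [Finset.card_insert_of_notMem hf, pow_succ', mul_assoc]
    convert norm_sum_mul_avgDev_le (s := Finset.univ) (J := killedChars σ f)
      (c := fun ψ y => ψ (v y)) (ih fun h => hψ (h.mul_left f)) (fun ρ hρ => ?_) using 3 with y
    · rw [addSieve_insert σ hf]; ring
    · convert ih (ψ := ψ * ρ) ?_ using 3 with y
      · rw [AddChar.mul_apply]; ring
      · refine fun h => hψ fun x => ?_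
        have h1 := h.mul_left f x
        have h2 := (mem_killedChars.mp hρ).2.mul_right (∏ f ∈ T, f) x
        rwa [AddChar.mul_apply, h2, mul_one] at h1

lemma norm_sum_mul_addSieve_sub_one_le (σ : Module.End K L) {T : Finset K[X]} {φ : L → ℂ}
    {v : L → L} {B : ℝ} (hB0 : 0 ≤ B)
    (hB : ∀ ψ : AddChar L ℂ, ψ ≠ 1 → ‖∑ y, φ y * ψ (v y)‖ ≤ B)
    (hT : (T : Set K[X]).Pairwise IsCoprime) :
    ‖∑ y, φ y * (addSieve σ T (v y) - 1)‖ ≤ (2 ^ T.card - 1) * B := by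
  classical
  induction T using Finset.induction_on with
  | empty => simp [addSieve]
  | insert f T hf ih =>
    have hfT : ∀ g ∈ T, IsCoprime f g := fun g hg =>
      hT (Finset.mem_coe.mpr (Finset.mem_insert_self _ _))
        (Finset.mem_coe.mpr (Finset.mem_insert_of_mem hg)) (fun h => hf (h ▸ hg))
    have hT' : (T : Set K[X]).Pairwise IsCoprime :=
      hT.mono (Finset.coe_subset.mpr (Finset.subset_insert _ _))
    have hsplit : ∑ y, φ y * (addSieve σ (insert f T) (v y) - 1) =
        ∑ y, φ y * (addSieve σ T (v y) - 1) - (∑ ρ ∈ killedChars σ f,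
          ∑ y, φ y * addSieve σ T (v y) * ρ (v y)) / (killedChars σ f).card := by
      have := sum_mul_avgDev Finset.univ (killedChars σ f) (fun y => φ y * addSieve σ T (v y))
        (fun ρ y => ρ (v y))
      simp only [addSieve_insert σ hf, mul_sub, mul_one, Finset.sum_sub_distrib, ← mul_assoc]
      rw [this]
      ring
    rw [hsplit, Finset.card_insert_of_notMem hf]
    refine (norm_sub_le _ _).trans ((add_le_add (ih hT')
      (norm_average_le (B := 2 ^ T.card * B) (by positivity) fun ρ hρ => ?_)).trans
      (le_of_eq (by ring)))
    have hρ' := mem_killedChars.mp hρ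
    convert norm_sum_addChar_mul_addSieve_le σ T hB (ψ := ρ) (fun h => hρ'.1 ?_) using 3 with y
    · ring
    · exact hρ'.2.eq_one_of_isCoprime h (IsCoprime.prod_right hfT)

/-- The additive sieve weight takes nonnegative real values. -/
lemma exists_addSieve_eq_ofReal (σ : Module.End K L) (T : Finset K[X]) (x : L) :
    ∃ r : ℝ, 0 ≤ r ∧ addSieve σ T x = r := by
  classical
  have key : ∀ f : K[X], ∃ r : ℝ, 0 ≤ r ∧ avgDev (killedChars σ f) (fun ψ => ψ x) = r := by
    intro f
    rcases (killedChars σ f).eq_empty_or_nonempty with h | hne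
    · exact ⟨1, zero_le_one, by simp [h, avgDev]⟩
    by_cases h : ∀ ψ ∈ killedChars σ f, ψ x = 1
    · exact ⟨0, le_rfl, by rw [avgDev_eq_zero hne h, Complex.ofReal_zero]⟩
    push Not at h
    obtain ⟨ψ, hψ, hψx⟩ := h
    refine ⟨1 + 1 / (killedChars σ f).card, by positivity, ?_⟩
    rw [avgDev_of_sum_eq_neg_one]
    · push_cast; rfl
    have hψ' := mem_killedChars.mp hψ
    have h1 : (1 : AddChar L ℂ) ∉ killedChars σ f := fun h => (mem_killedChars.mp h).1 rfl
    have hmem : ∀ ρ, ρ ∈ insert 1 (killedChars σ f) ↔ ρ.KilledBy σ f := by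
      intro ρ
      rw [Finset.mem_insert, mem_killedChars]
      constructor
      · rintro (rfl | h)
        · exact fun x => AddChar.one_apply _
        · exact h.2
      · intro h
        by_cases h0 : ρ = 1
        · exact Or.inl h0
        · exact Or.inr ⟨h0, h⟩
    have hsum : ψ x * ∑ ρ ∈ insert 1 (killedChars σ f), ρ x =
        ∑ ρ ∈ insert 1 (killedChars σ f), ρ x := by
      rw [Finset.mul_sum]
      refine Finset.sum_bij' (fun ρ _ => ψ * ρ) (fun ρ _ => ψ⁻¹ * ρ) ?_ ?_ ?_ ?_ ?_
      · intro ρ hρ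
        rw [hmem] at hρ ⊢
        exact fun y => by rw [AddChar.mul_apply, hψ'.2 y, hρ y, mul_one]
      · intro ρ hρ
        rw [hmem] at hρ ⊢
        exact fun y => by
          rw [AddChar.mul_apply, AddChar.inv_apply', hψ'.2 y, hρ y, inv_one, mul_one]
      · intro ρ _; simp
      · intro ρ _; simp
      · intro ρ _; rw [AddChar.mul_apply]
    have h0 : ∑ ρ ∈ insert 1 (killedChars σ f), ρ x = 0 := by
      by_contra h0
      exact hψx (mul_right_cancel₀ h0 (by rw [one_mul]; exact hsum))
    rw [Finset.sum_insert h1, AddChar.one_apply] at h0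
    linear_combination h0
  choose r hr0 hr using key
  refine ⟨∏ f ∈ T, r f, Finset.prod_nonneg fun f _ => hr0 f, ?_⟩
  rw [addSieve, Complex.ofReal_prod]
  exact Finset.prod_congr rfl fun f _ => hr f

lemma addSieve_eq_zero {σ : Module.End K L} {T : Finset K[X]} {f : K[X]} (hf : f ∈ T)
    (hsurj : ¬ Function.Surjective (aeval σ f)) (z : L) : addSieve σ T (aeval σ f z) = 0 := by
  refine Finset.prod_eq_zero hf (avgDev_eq_zero ?_ fun ψ hψ => (mem_killedChars.mp hψ).2 z)
  have hsurj' : ∃ a, a ∉ (aeval σ f).range := by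
    by_contra! h
    exact hsurj fun a => h a
  obtain ⟨a, ha⟩ := hsurj'
  obtain ⟨ψ, hψ⟩ := (AddChar.exists_apply_ne_zero
    (a := (Submodule.Quotient.mk a : L ⧸ (aeval σ f).range))).mpr
    (by rwa [Ne, Submodule.Quotient.mk_eq_zero])
  let π : L →+ L ⧸ (aeval σ f).range := (Submodule.mkQ (aeval σ f).range).toAddMonoidHom
  refine ⟨ψ.compAddMonoidHom π, mem_killedChars.mpr ⟨fun h => hψ ?_, fun x => ?_⟩⟩
  · exact DFunLike.congr_fun h a
  · have : π (aeval σ f x) = 0 :=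
      (Submodule.Quotient.mk_eq_zero _).mpr (LinearMap.mem_range_self _ x)
    rw [AddChar.compAddMonoidHom_apply, this, AddChar.map_zero_eq_one]

end AdditiveSieve

section Normality

variable (K L : Type*) [Field K] [Fintype K] [Field L] [Algebra K L]

/-- The Frobenius of `L` over the finite field `K`, as a `K`-linear endomorphism. -/
noncomputable def frobEnd : Module.End K L :=
  (FiniteField.frobeniusAlgHom K L).toLinearMap

lemma frobEnd_pow_apply (i : ℕ) (x : L) :
    (frobEnd K L ^ i) x = x ^ Fintype.card K ^ i := by
  induction i with
  | zero => simp
  | succ i ih =>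
    rw [pow_succ', Module.End.mul_apply, ih, pow_succ, pow_mul]
    rfl

variable [Fintype L]

lemma minpoly_frobEnd : minpoly K (frobEnd K L) = X ^ Module.finrank K L - 1 :=
  FiniteField.minpoly_frobeniusAlgHom K L

lemma aeval_frobEnd_X_pow_sub_one :
    aeval (frobEnd K L) (X ^ Module.finrank K L - 1 : K[X]) = 0 := by
  rw [← minpoly_frobEnd K L]
  exact minpoly.aeval _ _

lemma exists_forall_exists_aeval_frobEnd_eq :
    ∃ η : L, ∀ x : L, ∃ f : K[X], aeval (frobEnd K L) f η = x := by
  refine ⟨IsGalois.normalBasis K L 1, fun x => ?_⟩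
  have hx : x ∈ Submodule.span K (Set.range (IsGalois.normalBasis K L)) := by
    rw [Module.Basis.span_eq]; trivial
  induction hx using Submodule.span_induction with
  | mem x hx =>
    obtain ⟨e, rfl⟩ := hx
    obtain ⟨i, hi⟩ := (FiniteField.bijective_frobeniusAlgEquivOfAlgebraic_pow K L).2 e
    refine ⟨X ^ (i : ℕ), ?_⟩
    rw [map_pow, aeval_X, frobEnd_pow_apply, IsGalois.normalBasis_apply e, ← hi]
    simp only [AlgEquiv.coe_pow, FiniteField.coe_frobeniusAlgEquivOfAlgebraic_iterate]
  | zero => exact ⟨0, by simp⟩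
  | add x y _ _ hx hy =>
    obtain ⟨f, rfl⟩ := hx
    obtain ⟨g, rfl⟩ := hy
    exact ⟨f + g, by simp⟩
  | smul c x _ hx =>
    obtain ⟨f, rfl⟩ := hx
    exact ⟨c • f, by simp⟩

variable {K L}

lemma aeval_frobEnd_mem_conjSpan (f : K[X]) (α : L) :
    aeval (frobEnd K L) f α ∈ conjSpan K (Fintype.card K) (Module.finrank K L) α := by
  have hm : (X ^ Module.finrank K L - 1 : K[X]).Monic := by
    simpa using monic_X_pow_sub_C (1 : K) Module.finrank_pos.ne'
  have hdeg : (X ^ Module.finrank K L - 1 : K[X]).natDegree = Module.finrank K L := by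
    simpa using natDegree_X_pow_sub_C (n := Module.finrank K L) (r := (1 : K))
  rw [← aeval_modByMonic_eq_self_of_root (aeval_frobEnd_X_pow_sub_one K L),
    aeval_eq_sum_range' (n := Module.finrank K L), LinearMap.sum_apply]
  · refine Submodule.sum_mem _ fun i hi => ?_
    rw [LinearMap.smul_apply, frobEnd_pow_apply]
    exact Submodule.smul_mem _ _ (Submodule.subset_span ⟨⟨i, Finset.mem_range.mp hi⟩, rfl⟩)
  · refine (natDegree_modByMonic_lt f hm fun h => ?_).trans_eq hdeg
    have := Module.finrank_pos (R := K) (M := L)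
    rw [h, natDegree_one] at hdeg
    omega

lemma not_surjective_aeval_frobEnd {f : K[X]} (hf : Irreducible f)
    (hdvd : f ∣ X ^ Module.finrank K L - 1) :
    ¬ Function.Surjective (aeval (frobEnd K L) f) := by
  obtain ⟨g, hg⟩ := hdvd
  intro hsurj
  have hne : (X ^ Module.finrank K L - 1 : K[X]) ≠ 0 := by
    simpa using X_pow_sub_C_ne_zero Module.finrank_pos (1 : K)
  have hg0 : aeval (frobEnd K L) g = 0 := by
    ext x
    obtain ⟨z, rfl⟩ := hsurj x
    rw [← Module.End.mul_apply, ← map_mul, mul_comm, ← hg, aeval_frobEnd_X_pow_sub_one]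
    rfl
  have h1 := minpoly.dvd K (frobEnd K L) hg0
  rw [minpoly_frobEnd, hg] at h1
  have hgne : g ≠ 0 := by rintro rfl; simp [hne] at hg
  obtain ⟨c, hc⟩ := h1
  exact hf.not_isUnit (IsUnit.of_mul_eq_one c (mul_right_cancel₀ hgne
    (by linear_combination -hc)))

/-- An element that is not normal lies in the image of `f(σ)` for some monic irreducible
factor `f` of `X ^ n - 1`, where `σ` is the Frobenius. -/
lemma exists_irreducible_aeval_frobEnd_eq {α : L}
    (h : conjSpan K (Fintype.card K) (Module.finrank K L) α ≠ ⊤) :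
    ∃ f : K[X], f.Monic ∧ Irreducible f ∧ f ∣ X ^ Module.finrank K L - 1 ∧
      ∃ z, aeval (frobEnd K L) f z = α := by
  classical
  obtain ⟨η, hη⟩ := exists_forall_exists_aeval_frobEnd_eq K L
  obtain ⟨a, ha⟩ := hη α
  have hne : (X ^ Module.finrank K L - 1 : K[X]) ≠ 0 := by
    simpa using X_pow_sub_C_ne_zero Module.finrank_pos (1 : K)
  have hcop : ¬ IsCoprime a (X ^ Module.finrank K L - 1 : K[X]) := by
    rintro ⟨c, d, hcd⟩
    refine h (eq_top_iff.mpr fun x _ => ?_)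
    have hcη : aeval (frobEnd K L) c α = η := by
      have := congrArg (fun f => aeval (frobEnd K L) f η) hcd
      simpa only [map_add, map_mul, LinearMap.add_apply, Module.End.mul_apply, ha,
        aeval_frobEnd_X_pow_sub_one, LinearMap.zero_apply, map_zero, add_zero, map_one,
        Module.End.one_apply] using this
    obtain ⟨f, rfl⟩ := hη x
    rw [← hcη, ← Module.End.mul_apply, ← map_mul]
    exact aeval_frobEnd_mem_conjSpan _ _
  have : ∃ f, Irreducible f ∧ f ∣ a ∧ f ∣ (X ^ Module.finrank K L - 1 : K[X]) := by
    by_contra! hno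
    exact hcop (isCoprime_of_irreducible_dvd (fun h => hne h.2) hno)
  obtain ⟨f, hf, hfa, hfn⟩ := this
  refine ⟨normalize f, monic_normalize hf.ne_zero, (normalize_associated f).symm.irreducible hf,
    normalize_dvd_iff.mpr hfn, ?_⟩
  obtain ⟨b, hb⟩ := normalize_dvd_iff.mpr hfa
  exact ⟨aeval (frobEnd K L) b η, by rw [← Module.End.mul_apply, ← map_mul, ← hb, ha]⟩

end Normality

section SquarefreeDivisors

lemma pairwise_isCoprime_of_monic_irreducible {K : Type*} [Field K] {T : Finset K[X]}
    (hT : ∀ f ∈ T, f.Monic ∧ Irreducible f) : (T : Set K[X]).Pairwise IsCoprime := by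
  intro f hf g hg hfg
  refine ((hT f hf).2.isCoprime_or_dvd g).resolve_right fun h => hfg ?_
  exact eq_of_monic_of_associated (hT f hf).1 (hT g hg).1
    ((hT f hf).2.associated_of_dvd (hT g hg).2 h)

/-- A nonzero polynomial over a finite field has at least `2 ^ r` monic squarefree divisors
if it has `r` monic irreducible divisors. -/
lemma two_pow_card_le_Wpoly {K : Type*} [Field K] [Finite K] {f : K[X]} (hf : f ≠ 0)
    {T : Finset K[X]} (hT : ∀ g ∈ T, g.Monic ∧ Irreducible g) (hdvd : ∀ g ∈ T, g ∣ f) :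
    2 ^ T.card ≤ Wpoly f := by
  classical
  have hcop := pairwise_isCoprime_of_monic_irreducible hT
  rw [← Finset.card_powerset, ← Set.ncard_coe_finset, Wpoly]
  have hsub : ∀ S ∈ (T.powerset : Set (Finset K[X])), S ⊆ T := fun S hS =>
    Finset.mem_powerset.mp hS
  refine Set.ncard_le_ncard_of_injOn (fun S => ∏ g ∈ S, g) ?_ ?_ ?_
  · intro S hS
    have hcopS : (S : Set K[X]).Pairwise IsCoprime := hcop.mono (hsub S hS)
    refine ⟨monic_prod_of_monic _ _ fun g hg => (hT g (hsub S hS hg)).1, ?_, ?_⟩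
    · exact Finset.squarefree_prod_of_pairwise_isCoprime
        (fun a ha b hb hab => (hcopS ha hb hab).isRelPrime)
        fun g hg => (hT g (hsub S hS hg)).2.squarefree
    · exact Finset.prod_dvd_of_coprime hcopS fun g hg => hdvd g (hsub S hS hg)
  · have key : ∀ S ⊆ T, ∀ S' ⊆ T, ∏ g ∈ S, g = ∏ g ∈ S', g → S ⊆ S' := by
      intro S hS S' hS' h g hg
      have h1 : g ∣ ∏ r ∈ S', r := h ▸ Finset.dvd_prod_of_mem _ hg
      obtain ⟨r, hr, hgr⟩ := (Prime.dvd_finsetProd_iff (hT g (hS hg)).2.prime _).mp h1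
      have : g = r := by
        by_contra hne
        exact (hT g (hS hg)).2.not_isUnit
          ((hcop (hS hg) (hS' hr) hne).isUnit_of_dvd' dvd_rfl hgr)
      exact this ▸ hr
    intro S hS S' hS' h
    exact Finset.Subset.antisymm (key S (hsub S hS) S' (hsub S' hS') h)
      (key S' (hsub S' hS') S (hsub S hS) h.symm)
  · have hfin : (degreeLT K (f.natDegree + 1) : Set K[X]).Finite :=
      @Set.toFinite _ _ (Module.finite_of_finite K (M := degreeLT K (f.natDegree + 1)))
    refine hfin.subset fun d hd => ?_
    rw [SetLike.mem_coe, mem_degreeLT]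
    exact (degree_le_natDegree).trans_lt
      (by exact_mod_cast Nat.lt_succ_of_le (natDegree_le_of_dvd hd.2.2 hf))

end SquarefreeDivisors

section Primitivity

variable {F : Type*} [Field F]

lemma avgDev_mulChar_mul {χ : MulChar F ℂ} {ℓ : ℕ} (hℓ : ℓ.Prime) (hχ : χ ^ ℓ = 1) {y : F}
    (hy : y ≠ 0) :
    avgDev (Finset.Ico 1 ℓ) (fun j => (χ ^ j) y) * (1 - 1 / ℓ) = if χ y = 1 then 0 else 1 := by
  have hpow : ∀ j ∈ Finset.Ico 1 ℓ, (χ ^ j) y = χ y ^ j := fun j hj =>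
    MulChar.pow_apply' χ (Nat.one_le_iff_ne_zero.mp (Finset.mem_Ico.mp hj).1) y
  split_ifs with h
  · rw [avgDev_eq_zero ⟨1, by simp [hℓ.one_lt]⟩, zero_mul]
    intro j hj
    rw [hpow j hj, h, one_pow]
  · have h1 : χ y ^ ℓ = 1 := by
      rw [← MulChar.pow_apply' χ hℓ.ne_zero, hχ, MulChar.one_apply (IsUnit.mk0 y hy)]
    have hsum : ∑ j ∈ Finset.Ico 1 ℓ, (χ ^ j) y = -1 := by
      rw [Finset.sum_congr rfl hpow]
      have h2 := geom_sum_eq h ℓ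
      rw [h1, sub_self, zero_div, Finset.range_eq_Ico, Finset.sum_eq_sum_Ico_succ_bot hℓ.pos,
        pow_zero] at h2
      linear_combination h2
    rw [avgDev_of_sum_eq_neg_one hsum, Nat.card_Ico, Nat.cast_sub hℓ.one_le, Nat.cast_one]
    have h3 : (ℓ : ℂ) ≠ 0 := by exact_mod_cast hℓ.ne_zero
    have h4 : (ℓ : ℂ) - 1 ≠ 0 := sub_ne_zero.mpr (by exact_mod_cast hℓ.one_lt.ne')
    field_simp
    ring

lemma mulSieve_mul_prod {χ : ℕ → MulChar F ℂ} {S : Finset ℕ} (hS : ∀ ℓ ∈ S, ℓ.Prime)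
    (hχ : ∀ ℓ ∈ S, χ ℓ ^ ℓ = 1) {y : F} (hy : y ≠ 0) [Decidable (∀ ℓ ∈ S, χ ℓ y ≠ 1)] :
    mulSieve χ S y * ∏ ℓ ∈ S, (1 - 1 / (ℓ : ℂ)) = if ∀ ℓ ∈ S, χ ℓ y ≠ 1 then 1 else 0 := by
  rw [mulSieve, ← Finset.prod_mul_distrib,
    Finset.prod_congr rfl fun ℓ hℓ => avgDev_mulChar_mul (hS ℓ hℓ) (hχ ℓ hℓ) hy]
  split_ifs with h
  · exact Finset.prod_eq_one fun ℓ hℓ => if_neg (h ℓ hℓ)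
  · push Not at h
    obtain ⟨ℓ, hℓ, h1⟩ := h
    exact Finset.prod_eq_zero hℓ (if_pos h1)

lemma orderOf_eq_card_sub_one_of_forall_mulChar_ne_one [Fintype F] {χ : ℕ → MulChar F ℂ}
    {y : F} (hy : y ≠ 0)
    (hχ : ∀ ℓ ∈ (Fintype.card F - 1).primeFactors, χ ℓ ^ ℓ = 1 ∧ χ ℓ y ≠ 1) :
    orderOf y = Fintype.card F - 1 := by
  classical
  obtain ⟨g, hg⟩ := IsCyclic.exists_monoid_generator (α := Fˣ)
  obtain ⟨k, hk⟩ := (Submonoid.mem_powers_iff _ _).mp (hg (Units.mk0 y hy))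
  have hordg : orderOf g = Fintype.card F - 1 := by
    rw [← Fintype.card_units, ← Nat.card_eq_fintype_card]
    exact orderOf_eq_card_of_forall_mem_zpowers fun x =>
      Subgroup.mem_zpowers_iff.mpr (by
        obtain ⟨j, hj⟩ := (Submonoid.mem_powers_iff _ _).mp (hg x)
        exact ⟨j, by rw [zpow_natCast, hj]⟩)
  have hyk : y = (g : F) ^ k := by
    have := congrArg Units.val hk
    simpa using this.symm
  have hcard : Fintype.card F - 1 ≠ 0 := by
    have := Fintype.one_lt_card (α := F)
    omega
  have hcop : Nat.Coprime (orderOf g) k := by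
    rw [hordg]
    by_contra hne
    obtain ⟨ℓ, hℓ, hd⟩ := Nat.exists_prime_and_dvd hne
    obtain ⟨h1, h2⟩ := hχ ℓ (Nat.mem_primeFactors.mpr
      ⟨hℓ, hd.trans (Nat.gcd_dvd_left _ _), hcard⟩)
    obtain ⟨m, rfl⟩ := hd.trans (Nat.gcd_dvd_right _ _)
    apply h2
    rw [hyk, map_pow, pow_mul, ← MulChar.pow_apply_coe, h1, MulChar.one_apply_coe, one_pow]
  rw [hyk, ← Units.val_pow_eq_pow_val, orderOf_units, hcop.orderOf_pow, hordg]

end Primitivity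

section CombinedSieve

variable {K L : Type*} [Field K] [Field L] [Algebra K L] [Fintype L]

lemma norm_sum_mulChar_mul_sieve_sub_one_le (hL : ringChar L ≠ 2) (χ : ℕ → MulChar L ℂ)
    (S : Finset ℕ) (σ : Module.End K L) {T : Finset K[X]}
    (hT : (T : Set K[X]).Pairwise IsCoprime) (ω : MulChar L ℂ) :
    ‖∑ y, ω y * mulSieve χ S y * (addSieve σ T (y ^ 2) - 1)‖ ≤
      2 ^ S.card * ((2 ^ T.card - 1) * (2 * √(Fintype.card L))) :=
  norm_sum_mulChar_mul_mulSieve_le χ S (fun ρ => norm_sum_mul_addSieve_sub_one_le σ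
    (v := fun y => y ^ 2) (by positivity)
    (fun _ hψ => norm_sum_mulChar_mul_addChar_sq_le hL ρ hψ) hT) ω

lemma norm_sum_one_mul_sieve_sub_le (hL : ringChar L ≠ 2) {χ : ℕ → MulChar L ℂ}
    {S : Finset ℕ} (hS : ∀ ℓ ∈ S, ℓ.Prime) (hχ : ∀ ℓ ∈ S, orderOf (χ ℓ) = ℓ)
    (σ : Module.End K L) {T : Finset K[X]} (hT : (T : Set K[X]).Pairwise IsCoprime) :
    ‖∑ y, (1 : MulChar L ℂ) y * mulSieve χ S y * addSieve σ T (y ^ 2)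
        - ((Fintype.card L : ℂ) - 1)‖ ≤
      2 ^ S.card * ((2 ^ T.card - 1) * (2 * √(Fintype.card L))) := by
  rw [← sum_one_mul_mulSieve hS hχ, ← Finset.sum_sub_distrib]
  simpa only [mul_sub, mul_one] using norm_sum_mulChar_mul_sieve_sub_one_le hL χ S σ hT 1

lemma norm_sum_insert_sieve_sub_le (hL : ringChar L ≠ 2) {χ : ℕ → MulChar L ℂ}
    {S : Finset ℕ} {ℓ : ℕ} (hS : ∀ r ∈ S, r.Prime) (hℓ : ℓ.Prime) (hℓS : ℓ ∉ S)
    (hχ : ∀ r ∈ S, orderOf (χ r) = r) (hχℓ : orderOf (χ ℓ) = ℓ)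
    (σ : Module.End K L) {T : Finset K[X]} (hT : (T : Set K[X]).Pairwise IsCoprime) :
    ‖∑ y, (1 : MulChar L ℂ) y * mulSieve χ (insert ℓ S) y * addSieve σ T (y ^ 2)
        - ∑ y, (1 : MulChar L ℂ) y * mulSieve χ S y * addSieve σ T (y ^ 2)‖ ≤
      2 ^ S.card * ((2 ^ T.card - 1) * (2 * √(Fintype.card L))) := by
  have hsplit := sum_mul_avgDev Finset.univ (Finset.Ico 1 ℓ)
    (fun y => (1 : MulChar L ℂ) y * mulSieve χ S y * addSieve σ T (y ^ 2))
    (fun j y => (χ ℓ ^ j) y)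
  have hins : ∑ y, (1 : MulChar L ℂ) y * mulSieve χ (insert ℓ S) y * addSieve σ T (y ^ 2) =
      ∑ y, (1 : MulChar L ℂ) y * mulSieve χ S y * addSieve σ T (y ^ 2) *
        avgDev (Finset.Ico 1 ℓ) (fun j => (χ ℓ ^ j) y) := by
    refine Finset.sum_congr rfl fun y _ => ?_
    rw [mulSieve_insert χ hℓS]; ring
  rw [hins, hsplit, sub_sub_cancel_left, norm_neg]
  have h2 : (1 : ℝ) ≤ 2 ^ T.card := one_le_pow₀ (by norm_num)
  refine norm_average_le (mul_nonneg (by positivity)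
    (mul_nonneg (by linarith) (by positivity))) fun j hj => ?_
  have hzero := sum_mulChar_mul_mulSieve_eq_zero (S := S) (ω := χ ℓ ^ j)
    (fun r hr => by simpa only [hχ r hr] using pow_orderOf_eq_one (χ r))
    (mulChar_pow_prod_ne_one hS hℓ hχℓ hℓS hj)
  have := norm_sum_mulChar_mul_sieve_sub_one_le hL χ S σ hT (χ ℓ ^ j)
  simp only [mul_sub, mul_one, Finset.sum_sub_distrib] at this
  rw [hzero, sub_zero] at this
  convert this using 3 with y
  have h1 : (1 : MulChar L ℂ) y * (χ ℓ ^ j) y = (χ ℓ ^ j) y := by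
    rw [← MulChar.mul_apply, one_mul]
  linear_combination (mulSieve χ S y * addSieve σ T (y ^ 2)) * h1

/-- The real number counting, with nonnegative weights supported on the elements whose
squares avoid the images of `f(σ)` for `f ∈ T`, the nonzero elements `y` with `χ ℓ y ≠ 1` for
all `ℓ ∈ S`. -/
noncomputable def sieveCount (χ : ℕ → MulChar L ℂ) (σ : Module.End K L) (T : Finset K[X])
    (S : Finset ℕ) : ℝ :=
  open Classical in
  ∑ y with y ≠ 0 ∧ ∀ ℓ ∈ S, χ ℓ y ≠ 1, (addSieve σ T (y ^ 2)).re

lemma ofReal_re_addSieve (σ : Module.End K L) (T : Finset K[X]) (x : L) :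
    ((addSieve σ T x).re : ℂ) = addSieve σ T x := by
  obtain ⟨r, -, h⟩ := exists_addSieve_eq_ofReal σ T x
  rw [h, Complex.ofReal_re]

lemma re_addSieve_nonneg (σ : Module.End K L) (T : Finset K[X]) (x : L) :
    0 ≤ (addSieve σ T x).re := by
  obtain ⟨r, hr, h⟩ := exists_addSieve_eq_ofReal σ T x
  rwa [h, Complex.ofReal_re]

lemma prod_one_sub_inv_pos {S : Finset ℕ} (hS : ∀ ℓ ∈ S, ℓ.Prime) :
    0 < ∏ ℓ ∈ S, (1 - 1 / (ℓ : ℝ)) :=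
  Finset.prod_pos fun ℓ hℓ => by
    have : (1 : ℝ) < ℓ := by exact_mod_cast (hS ℓ hℓ).one_lt
    rw [sub_pos, div_lt_one (by linarith)]
    exact this

lemma ofReal_sieveCount_div {χ : ℕ → MulChar L ℂ} (σ : Module.End K L) (T : Finset K[X])
    {S : Finset ℕ} (hS : ∀ ℓ ∈ S, ℓ.Prime) (hχ : ∀ ℓ ∈ S, orderOf (χ ℓ) = ℓ) :
    ((sieveCount χ σ T S / ∏ ℓ ∈ S, (1 - 1 / (ℓ : ℝ)) : ℝ) : ℂ) =
      ∑ y, (1 : MulChar L ℂ) y * mulSieve χ S y * addSieve σ T (y ^ 2) := by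
  classical
  have hθ := (prod_one_sub_inv_pos hS).ne'
  have hθ' : ((∏ ℓ ∈ S, (1 - 1 / (ℓ : ℝ)) : ℝ) : ℂ) = ∏ ℓ ∈ S, (1 - 1 / (ℓ : ℂ)) := by
    push_cast; rfl
  rw [Complex.ofReal_div, div_eq_iff (by exact_mod_cast hθ), hθ', Finset.sum_mul, sieveCount,
    Complex.ofReal_sum, Finset.sum_filter]
  refine Finset.sum_congr rfl fun y _ => ?_
  rw [ofReal_re_addSieve]
  by_cases hy : y = 0
  · simp [hy, MulChar.map_zero (1 : MulChar L ℂ)]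
  · have h := mulSieve_mul_prod hS
      (fun r hr => by simpa only [hχ r hr] using pow_orderOf_eq_one (χ r)) hy (χ := χ)
    rw [MulChar.one_apply (IsUnit.mk0 y hy), one_mul, mul_right_comm, h]
    simp [hy]

/-- The sieving inequality: if no element survives the whole sieve, the partial counts are
bounded in terms of the count for the core set of primes. -/
lemma sum_sieveCount_insert_le {χ : ℕ → MulChar L ℂ} (σ : Module.End K L) (T : Finset K[X])
    (S : Finset ℕ) {s : ℕ} (pr : Fin s → ℕ)
    (h : ∀ y : L, y ≠ 0 → (∀ ℓ ∈ S, χ ℓ y ≠ 1) → (∀ i, χ (pr i) y ≠ 1) →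
      addSieve σ T (y ^ 2) = 0) :
    ∑ i, sieveCount χ σ T (insert (pr i) S) ≤ ((s : ℝ) - 1) * sieveCount χ σ T S := by
  classical
  simp only [sieveCount, Finset.sum_filter]
  rw [Finset.sum_comm, Finset.mul_sum]
  refine Finset.sum_le_sum fun y _ => ?_
  by_cases hy : y ≠ 0 ∧ ∀ ℓ ∈ S, χ ℓ y ≠ 1
  · rw [if_pos hy]
    have hr := re_addSieve_nonneg σ T (y ^ 2)
    by_cases hall : ∀ i, χ (pr i) y ≠ 1
    · simp [h y hy.1 hy.2 hall]
    · push Not at hall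
      obtain ⟨i₀, hi₀⟩ := hall
      have hle : ∀ i ∈ Finset.univ.erase i₀,
          (if y ≠ 0 ∧ ∀ ℓ ∈ insert (pr i) S, χ ℓ y ≠ 1 then (addSieve σ T (y ^ 2)).re else 0)
            ≤ (addSieve σ T (y ^ 2)).re := fun i _ => by
        split_ifs
        · exact le_rfl
        · exact hr
      rw [← Finset.add_sum_erase _ _ (Finset.mem_univ i₀), if_neg fun h' =>
        h'.2 _ (Finset.mem_insert_self _ _) hi₀, zero_add]
      refine (Finset.sum_le_card_nsmul _ _ _ hle).trans (le_of_eq ?_)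
      have hs : 1 ≤ s := Nat.one_le_iff_ne_zero.mpr (by rintro rfl; exact i₀.elim0)
      rw [Finset.card_erase_of_mem (Finset.mem_univ _), Finset.card_univ, Fintype.card_fin,
        nsmul_eq_mul, Nat.cast_sub hs, Nat.cast_one]
  · rw [if_neg hy, mul_zero]
    refine Finset.sum_nonpos fun i _ => ?_
    rw [if_neg fun h' => hy ⟨h'.1, fun ℓ hℓ => h'.2 ℓ (Finset.mem_insert_of_mem hℓ)⟩]

/-- The combined sieve: a sufficiently large field contains a nonzero element that survives
the multiplicative sieve and whose square survives the additive sieve. -/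
lemma exists_forall_mulChar_ne_one_and_addSieve_ne_zero (hL : ringChar L ≠ 2)
    {χ : ℕ → MulChar L ℂ} {S : Finset ℕ} {s : ℕ} {pr : Fin s → ℕ}
    (hS : ∀ ℓ ∈ S, ℓ.Prime) (hχ : ∀ ℓ ∈ S, orderOf (χ ℓ) = ℓ)
    (hpr : ∀ i, (pr i).Prime) (hprS : ∀ i, pr i ∉ S) (hχpr : ∀ i, orderOf (χ (pr i)) = pr i)
    (σ : Module.End K L) {T : Finset K[X]} (hT : (T : Set K[X]).Pairwise IsCoprime)
    (hδ : (0 : ℝ) < 1 - ∑ i, (1 : ℝ) / (pr i))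
    (hbig : √(Fintype.card L) > 2 * 2 ^ S.card * 2 ^ T.card *
      (((s : ℝ) - 1) / (1 - ∑ i, (1 : ℝ) / (pr i)) + 2)) :
    ∃ y : L, y ≠ 0 ∧ (∀ ℓ ∈ S, χ ℓ y ≠ 1) ∧ (∀ i, χ (pr i) y ≠ 1) ∧
      addSieve σ T (y ^ 2) ≠ 0 := by
  by_contra! hno
  set δ : ℝ := 1 - ∑ i, (1 : ℝ) / (pr i) with hδdef
  set E : ℝ := 2 ^ S.card * ((2 ^ T.card - 1) * (2 * √(Fintype.card L))) with hE
  set θ : ℝ := ∏ ℓ ∈ S, (1 - 1 / (ℓ : ℝ)) with hθdef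
  have hθ : 0 < θ := prod_one_sub_inv_pos hS
  set N : ℝ := sieveCount χ σ T S / θ with hN
  have hmain : |N - ((Fintype.card L : ℝ) - 1)| ≤ E := by
    have := norm_sum_one_mul_sieve_sub_le hL hS hχ σ hT
    rw [← ofReal_sieveCount_div σ T hS hχ] at this
    rw [← Real.norm_eq_abs, ← Complex.norm_real]
    push_cast at this ⊢
    convert this using 3
    simp [hN, hθdef]
  have hinsert : ∀ i, (1 - 1 / (pr i : ℝ)) * θ * (N - E) ≤
      sieveCount χ σ T (insert (pr i) S) := by
    intro i
    have hS' : ∀ ℓ ∈ insert (pr i) S, ℓ.Prime := by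
      simpa using ⟨hpr i, hS⟩
    have hχ' : ∀ ℓ ∈ insert (pr i) S, orderOf (χ ℓ) = ℓ := by
      simpa using ⟨hχpr i, hχ⟩
    have hpos := prod_one_sub_inv_pos hS'
    have := norm_sum_insert_sieve_sub_le hL hS (hpr i) (hprS i) hχ (hχpr i) σ hT
    rw [← ofReal_sieveCount_div σ T hS hχ, ← ofReal_sieveCount_div σ T hS' hχ',
      ← Complex.ofReal_sub, Complex.norm_real, Real.norm_eq_abs] at this
    have h1 := (abs_le.mp this).1
    rw [Finset.prod_insert (hprS i)] at hpos h1
    have h2 : N - E ≤ sieveCount χ σ T (insert (pr i) S) / ((1 - 1 / (pr i : ℝ)) * θ) := by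
      linarith
    rw [le_div_iff₀ hpos] at h2
    linarith
  have hsieve := sum_sieveCount_insert_le (χ := χ) σ T S pr hno
  have hsum : ((s : ℝ) - 1 + δ) * (N - E) ≤ ((s : ℝ) - 1) * N := by
    have h1 := (Finset.sum_le_sum fun i (_ : i ∈ Finset.univ) => hinsert i).trans hsieve
    have h2 : ∑ i, (1 - 1 / (pr i : ℝ)) = (s : ℝ) - 1 + δ := by
      rw [Finset.sum_sub_distrib, hδdef]
      simp
    rw [← Finset.sum_mul, ← Finset.sum_mul, h2] at h1
    have h3 : sieveCount χ σ T S = θ * N := by rw [hN]; field_simp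
    rw [h3] at h1
    refine le_of_mul_le_mul_left ?_ hθ
    linarith
  set A : ℝ := ((s : ℝ) - 1) / δ + 2 with hA
  have hδ1 : δ ≤ 1 := by
    have : (0 : ℝ) ≤ ∑ i, (1 : ℝ) / (pr i) := Finset.sum_nonneg fun i _ => by positivity
    linarith
  have hA1 : 1 ≤ A := by
    rcases Nat.eq_zero_or_pos s with rfl | hs
    · have : δ = 1 := by simp [hδdef]
      rw [hA, this]; norm_num
    · have h1 : (1 : ℝ) ≤ s := by exact_mod_cast hs
      have : 0 ≤ ((s : ℝ) - 1) / δ := div_nonneg (by linarith) hδ.le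
      linarith
  have hAδ : A * δ = (s : ℝ) - 1 + 2 * δ := by
    rw [hA]; field_simp
  have hupper : (Fintype.card L : ℝ) - 1 ≤ A * E := by
    have h1 := (abs_le.mp hmain).1
    refine le_of_mul_le_mul_left ?_ hδ
    calc δ * ((Fintype.card L : ℝ) - 1) ≤ δ * (N + E) :=
          mul_le_mul_of_nonneg_left (by linarith) hδ.le
      _ ≤ ((s : ℝ) - 1 + 2 * δ) * E := by linarith
      _ = δ * (A * E) := by rw [← hAδ]; ring
  have hsq : √(Fintype.card L : ℝ) * √(Fintype.card L : ℝ) = Fintype.card L :=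
    Real.mul_self_sqrt (by positivity)
  set Q : ℝ := √(Fintype.card L : ℝ) with hQ
  have hQ1 : 1 ≤ Q := Real.one_le_sqrt.mpr (by exact_mod_cast Fintype.card_pos)
  have hS1 : (1 : ℝ) ≤ 2 ^ S.card := one_le_pow₀ (by norm_num)
  have h4 : 1 ≤ A * 2 ^ S.card := one_le_mul_of_one_le_of_one_le hA1 hS1
  have h5 : 1 ≤ A * 2 ^ S.card * Q := one_le_mul_of_one_le_of_one_le h4 hQ1
  have h6 : Q * (2 * 2 ^ S.card * 2 ^ T.card * A) < Q * Q :=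
    mul_lt_mul_of_pos_left hbig (by linarith)
  have h7 : A * E = Q * (2 * 2 ^ S.card * 2 ^ T.card * A) - 2 * (A * 2 ^ S.card * Q) := by
    rw [hE]; ring
  linarith

end CombinedSieve

/-- Sieving criterion: let `n = p^k u` with `gcd(u, p) = 1`, let `q'` be the largest
squarefree divisor of `q^n - 1`, let `p_1, …, p_s` be distinct primes dividing `q'` with
`δ = 1 - Σ 1/pᵢ > 0`, and `q₀ = q'/(p_1 ⋯ p_s)`. If
`q^{n/2} > 2 W(q₀) W(x^u - 1) ((s-1)/δ + 2)`, then there exists an element of `F_{q^n}`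
that is simultaneously `2`-primitive and normal over `F_q`. -/
theorem stmt_15 (p t q n k u s q₀ : ℕ) (hp : p.Prime) (hodd : Odd p) (ht : 1 ≤ t)
    (hq : q = p ^ t) (hgcd : Nat.gcd u p = 1) (hn : n = p ^ k * u)
    (pr : Fin s → ℕ) (hpr : ∀ i, (pr i).Prime) (hinj : Function.Injective pr)
    (hdvd : ∀ i, pr i ∣ ∏ ℓ ∈ (q ^ n - 1).primeFactors, ℓ)
    (hδ : (0 : ℝ) < 1 - ∑ i, (1 : ℝ) / (pr i))
    (hq₀ : q₀ = (∏ ℓ ∈ (q ^ n - 1).primeFactors, ℓ) / ∏ i, pr i)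
    (K L : Type*) [Field K] [Field L] [Algebra K L] [Fintype K] [Fintype L]
    (hK : Fintype.card K = q) (hL : Fintype.card L = q ^ n)
    (hineq : (q : ℝ) ^ ((n : ℝ) / 2) >
      2 * (Wnat q₀ : ℝ) * (Wpoly ((X : Polynomial K) ^ u - 1) : ℝ) *
        (((s : ℝ) - 1) / (1 - ∑ i, (1 : ℝ) / (pr i)) + 2)) :
    ∃ α : L, orderOf α = (q ^ n - 1) / 2 ∧ conjSpan K q n α = ⊤ := by
  classical
  have : Fact p.Prime := ⟨hp⟩
  have hcharK : CharP K p := charP_of_card_eq_prime_pow (hK.trans hq)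
  have hcharL : CharP L p := charP_of_injective_algebraMap (algebraMap K L).injective p
  have hp2 : p ≠ 2 := by rintro rfl; exact absurd hodd (by decide)
  have hringChar : ringChar L ≠ 2 := by rwa [ringChar.eq L p]
  have hfinrank : Module.finrank K L = n := by
    have h1 := Module.card_eq_pow_finrank (K := K) (V := L)
    rw [hL, hK] at h1
    have h2 : 1 < q := hK ▸ Fintype.one_lt_card
    exact (Nat.pow_right_injective h2 h1).symm
  have hn0 : 0 < n := hfinrank ▸ Module.finrank_pos
  have hu0 : 0 < u := Nat.pos_of_ne_zero (by rintro rfl; simp at hn; omega)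
  -- the core set of primes
  set P : Finset ℕ := (q ^ n - 1).primeFactors with hP
  have hPprime : ∀ ℓ ∈ P, ℓ.Prime := fun ℓ hℓ => Nat.prime_of_mem_primeFactors hℓ
  have hprP : ∀ i, pr i ∈ P := fun i => by
    obtain ⟨r, hr, hd⟩ := (Prime.dvd_finsetProd_iff (hpr i).prime _).mp (hdvd i)
    rwa [(Nat.prime_dvd_prime_iff_eq (hpr i) (hPprime r hr)).mp hd]
  set S : Finset ℕ := P \ Finset.univ.image pr with hS
  have hSprime : ∀ ℓ ∈ S, ℓ.Prime := fun ℓ hℓ => hPprime ℓ (Finset.mem_sdiff.mp hℓ).1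
  have hW : Wnat q₀ = 2 ^ S.card := by
    have hprod : ∏ ℓ ∈ P, ℓ = (∏ ℓ ∈ S, ℓ) * ∏ i, pr i := by
      rw [← Finset.prod_image (s := Finset.univ) (g := pr) (f := fun ℓ => ℓ)
        (fun a _ b _ h => hinj h), Finset.prod_sdiff]
      exact fun ℓ hℓ => by
        obtain ⟨i, -, rfl⟩ := Finset.mem_image.mp hℓ
        exact hprP i
    rw [Wnat, hq₀, hprod, Nat.mul_div_cancel _ (Finset.prod_pos fun i _ => (hpr i).pos),
      Nat.primeFactors_prod hSprime]
  -- characters of prime order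
  have hchar : ∀ ℓ : ℕ, ∃ ω : MulChar L ℂ, ℓ ∈ P → orderOf ω = ℓ := fun ℓ => by
    by_cases hℓ : ℓ ∈ P
    · obtain ⟨ω, hω⟩ := MulChar.exists_mulChar_orderOf L (n := ℓ)
        (hL ▸ Nat.dvd_of_mem_primeFactors hℓ)
        (Complex.isPrimitiveRoot_exp ℓ (hPprime ℓ hℓ).ne_zero)
      exact ⟨ω, fun _ => hω⟩
    · exact ⟨1, fun h => absurd h hℓ⟩
  choose χ hχ using hchar
  -- irreducible factors
  have hXu : (X ^ u - 1 : K[X]) ≠ 0 := by simpa using X_pow_sub_C_ne_zero hu0 (1 : K)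
  have hXn : (X ^ n - 1 : K[X]) = (X ^ u - 1) ^ p ^ k := by
    rw [sub_pow_char_pow, one_pow, ← pow_mul, hn, mul_comm]
  set T : Finset K[X] :=
    (UniqueFactorizationMonoid.normalizedFactors (X ^ u - 1 : K[X])).toFinset with hTdef
  have hTmem : ∀ f ∈ T, f.Monic ∧ Irreducible f ∧ f ∣ X ^ u - 1 := fun f hf => by
    obtain ⟨h1, h2, h3⟩ := (UniqueFactorizationMonoid.mem_normalizedFactors_iff' hXu).mp
      (Multiset.mem_toFinset.mp hf)
    exact ⟨h2 ▸ monic_normalize h1.ne_zero, h1, h3⟩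
  have hTcop := pairwise_isCoprime_of_monic_irreducible
    fun f hf => ⟨(hTmem f hf).1, (hTmem f hf).2.1⟩
  have hTW : ((2 : ℝ) ^ T.card) ≤ Wpoly (X ^ u - 1 : K[X]) := by
    exact_mod_cast two_pow_card_le_Wpoly hXu
      (fun f hf => ⟨(hTmem f hf).1, (hTmem f hf).2.1⟩) fun f hf => (hTmem f hf).2.2
  have hA : 0 ≤ ((s : ℝ) - 1) / (1 - ∑ i, (1 : ℝ) / (pr i)) + 2 := by
    rcases Nat.eq_zero_or_pos s with rfl | hs
    · norm_num
    · have h1 : (1 : ℝ) ≤ s := by exact_mod_cast hs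
      have := div_nonneg (sub_nonneg.mpr h1) hδ.le
      linarith
  have hbig : √(Fintype.card L) > 2 * 2 ^ S.card * 2 ^ T.card *
      (((s : ℝ) - 1) / (1 - ∑ i, (1 : ℝ) / (pr i)) + 2) := by
    have hsqrt : √(Fintype.card L : ℝ) = (q : ℝ) ^ ((n : ℝ) / 2) := by
      rw [hL, Nat.cast_pow, Real.sqrt_eq_rpow, ← Real.rpow_natCast,
        ← Real.rpow_mul (Nat.cast_nonneg q), mul_one_div]
    rw [hsqrt]
    refine lt_of_le_of_lt ?_ hineq
    rw [hW]
    push_cast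
    gcongr
  obtain ⟨y, hy0, hyS, hypr, hyT⟩ := exists_forall_mulChar_ne_one_and_addSieve_ne_zero
    hringChar (χ := χ) hSprime (fun ℓ hℓ => hχ ℓ (Finset.mem_sdiff.mp hℓ).1) hpr
    (fun i hi => (Finset.mem_sdiff.mp hi).2 (Finset.mem_image_of_mem _ (Finset.mem_univ i)))
    (fun i => hχ _ (hprP i)) (frobEnd K L) hTcop hδ hbig
  refine ⟨y ^ 2, ?_, ?_⟩
  · have hord : orderOf y = Fintype.card L - 1 := by
      refine orderOf_eq_card_sub_one_of_forall_mulChar_ne_one (χ := χ) hy0 fun ℓ hℓ => ?_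
      rw [hL] at hℓ
      refine ⟨by simpa only [hχ ℓ hℓ] using pow_orderOf_eq_one (χ ℓ), ?_⟩
      by_cases hℓpr : ℓ ∈ Finset.univ.image pr
      · obtain ⟨i, -, rfl⟩ := Finset.mem_image.mp hℓpr
        exact hypr i
      · exact hyS ℓ (Finset.mem_sdiff.mpr ⟨hℓ, hℓpr⟩)
    have h2 : 2 ∣ orderOf y := by
      have := FiniteField.odd_card_of_char_ne_two hringChar
      rw [hord]
      omega
    rw [orderOf_pow_of_dvd two_ne_zero h2, hord, hL]
  · by_contra hne
    rw [← hK, ← hfinrank] at hne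
    obtain ⟨f, hfm, hfi, hfd, z, hz⟩ := exists_irreducible_aeval_frobEnd_eq hne
    refine hyT ?_
    rw [← hz]
    refine addSieve_eq_zero ?_ (not_surjective_aeval_frobEnd hfi hfd) z
    rw [hfinrank, hXn] at hfd
    exact Multiset.mem_toFinset.mpr ((UniqueFactorizationMonoid.mem_normalizedFactors_iff' hXu).mpr
      ⟨hfi, hfm.normalize_eq_self, hfi.prime.dvd_of_dvd_pow hfd⟩)
end

section
/- Let p ≥ 5 be a prime, q a power of p, and n = p^k u where k ≥ 1 and gcd(u, p) = 1. Then W((q^{p^k u} − 1)/(q^u − 1)) ≤ ε(q) · q^{(p^k − 1) u / (2 + log_2 p)}, where ε(q) = 2 if q = 5 and ε(q) = 1 otherwise, and log_2 denotes the base-2 logarithm. -/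
/-- The number of elements of a set of positive integers has factorial at most their product. -/
theorem factorial_card_le_prod_of_pos (s : Finset ℕ) (hs : ∀ x ∈ s, 1 ≤ x) :
    s.card.factorial ≤ ∏ x ∈ s, x := by
  induction s using Finset.induction_on_max with
  | empty => simp
  | insert a s hlt ih =>
    have ha : a ∉ s := fun h => lt_irrefl _ (hlt a h)
    have hcard : s.card + 1 ≤ a := by
      have hsub : s ⊆ Finset.Ico 1 a := fun x hx =>
        Finset.mem_Ico.2 ⟨hs x (Finset.mem_insert_of_mem hx), hlt x hx⟩
      have h1 := Finset.card_le_card hsub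
      have h2 := hs a (Finset.mem_insert_self a s)
      rw [Nat.card_Ico] at h1
      omega
    rw [Finset.card_insert_of_notMem ha, Finset.prod_insert ha, Nat.factorial_succ]
    exact Nat.mul_le_mul hcard (ih fun x hx => hs x (Finset.mem_insert_of_mem hx))

/-- Distinct integers `> 1` congruent to `1` modulo `d` have product at least `d ^ ω * ω!`. -/
theorem pow_mul_factorial_card_le_prod {d : ℕ} (s : Finset ℕ)
    (hs : ∀ r ∈ s, 1 < r ∧ d ∣ r - 1) :
    d ^ s.card * s.card.factorial ≤ ∏ r ∈ s, r := by
  have hinj : Set.InjOn (fun r => (r - 1) / d) s := by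
    intro a ha b hb hab
    have h1 := Nat.mul_div_cancel' (hs a ha).2
    have h2 := Nat.mul_div_cancel' (hs b hb).2
    have h3 := (hs a ha).1
    have h4 := (hs b hb).1
    simp only at hab
    rw [hab] at h1
    omega
  have hfac := factorial_card_le_prod_of_pos (s.image fun r => (r - 1) / d) (by
    intro x hx
    obtain ⟨r, hr, rfl⟩ := Finset.mem_image.1 hx
    obtain ⟨h1, h2⟩ := hs r hr
    exact (Nat.one_le_div_iff (Nat.pos_of_dvd_of_pos h2 (by omega))).2
      (Nat.le_of_dvd (by omega) h2))
  rw [Finset.card_image_of_injOn hinj, Finset.prod_image hinj] at hfac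
  calc d ^ s.card * s.card.factorial ≤ d ^ s.card * ∏ r ∈ s, (r - 1) / d :=
        Nat.mul_le_mul_left _ hfac
    _ = ∏ r ∈ s, d * ((r - 1) / d) := by rw [Finset.prod_mul_distrib, Finset.prod_const]
    _ ≤ ∏ r ∈ s, r := by
        refine Finset.prod_le_prod' fun r hr => ?_
        rw [Nat.mul_div_cancel' (hs r hr).2]
        omega

/-- A prime divisor of `1 + Q + ⋯ + Q ^ (p ^ k - 1)`, where `p ∣ Q` is an odd prime, is congruent
to `1` modulo `2 p`. -/
theorem two_mul_dvd_sub_one_of_dvd_geom_sum {p k Q r : ℕ} (hp : p.Prime) (hp2 : p ≠ 2)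
    (hQ : p ∣ Q) (hr : r.Prime) (h : r ∣ ∑ i ∈ Finset.range (p ^ k), Q ^ i) :
    2 * p ∣ r - 1 := by
  have := Fact.mk hr
  have hsum : ∑ i ∈ Finset.range (p ^ k), (Q : ZMod r) ^ i = 0 := by
    have := (ZMod.natCast_eq_zero_iff _ r).2 h
    exact_mod_cast this
  have hpow : (Q : ZMod r) ^ p ^ k = 1 := by
    have := mul_geom_sum (Q : ZMod r) (p ^ k)
    rw [hsum, mul_zero] at this
    exact (sub_eq_zero.1 this.symm)
  have hne : (Q : ZMod r) ≠ 1 := by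
    intro h1
    rw [h1] at hsum
    have h2 : ((p ^ k : ℕ) : ZMod r) = 0 := by simpa using hsum
    have h3 : r = p := (Nat.prime_dvd_prime_iff_eq hr hp).1
      (hr.dvd_of_dvd_pow ((ZMod.natCast_eq_zero_iff _ r).1 h2))
    rw [← h3] at hQ
    rw [(ZMod.natCast_eq_zero_iff _ r).2 hQ] at h1
    exact zero_ne_one h1
  have hpord : p ∣ orderOf (Q : ZMod r) := by
    obtain ⟨j, -, hj⟩ := (Nat.dvd_prime_pow hp).1 (orderOf_dvd_of_pow_eq_one hpow)
    rw [hj]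
    refine dvd_pow_self p ?_
    rintro rfl
    exact hne (orderOf_eq_one_iff.1 (by simpa using hj))
  have hQ0 : (Q : ZMod r) ≠ 0 := by
    intro h0
    rw [h0, zero_pow (pow_ne_zero _ hp.ne_zero)] at hpow
    exact zero_ne_one hpow
  have hpr : p ∣ r - 1 := hpord.trans (ZMod.orderOf_dvd_card_sub_one hQ0)
  have hodd : r ≠ 2 := by
    rintro rfl
    exact hp.one_lt.ne' (Nat.dvd_one.1 hpr)
  exact Nat.Coprime.mul_dvd_of_dvd_of_dvd ((Nat.coprime_primes Nat.prime_two hp).2 hp2.symm)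
    (hr.even_sub_one hodd).two_dvd hpr

theorem four_mul_geom_sum_le {Q : ℕ} (hQ : 5 ≤ Q) (m : ℕ) :
    4 * ∑ i ∈ Finset.range (m + 1), Q ^ i ≤ 5 * Q ^ m := by
  induction m with
  | zero => simp
  | succ m ih =>
    rw [Finset.sum_range_succ, pow_succ]
    nlinarith [Nat.mul_le_mul_left (Q ^ m) hQ]

theorem five_mul_two_pow_le_four_mul_factorial {w : ℕ} (hw : 4 ≤ w) :
    5 * 2 ^ w ≤ 4 * w.factorial := by
  induction w, hw using Nat.le_induction with
  | base => decide
  | succ w hw ih =>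
    rw [pow_succ, Nat.factorial_succ]
    nlinarith

/-- As `2 ^ (2 + log₂ p) = 4 p`, a bound on `(4 p) ^ w` gives one on `2 ^ w`. -/
theorem two_pow_le_rpow_of_pow_le {p q e w : ℕ} (hp : 1 ≤ p) (h : (4 * p) ^ w ≤ q ^ e) :
    (2 : ℝ) ^ w ≤ (q : ℝ) ^ ((e : ℝ) / (2 + Real.logb 2 p)) := by
  have hp0 : (0 : ℝ) < p := by exact_mod_cast hp
  have hL : 0 < 2 + Real.logb 2 p := by
    have := Real.logb_nonneg one_lt_two (show (1 : ℝ) ≤ p by exact_mod_cast hp)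
    linarith
  have h4p : (2 : ℝ) ^ (2 + Real.logb 2 p) = 4 * p := by
    rw [Real.rpow_add two_pos, Real.rpow_logb two_pos (by norm_num) hp0]
    norm_num
  have hreal : (4 * (p : ℝ)) ^ w ≤ (q : ℝ) ^ e := by exact_mod_cast h
  rw [← Real.rpow_le_rpow_iff (by positivity) (by positivity) hL,
    ← Real.rpow_mul (Nat.cast_nonneg q), div_mul_cancel₀ _ hL.ne', Real.rpow_natCast,
    ← Real.rpow_natCast 2 w, ← Real.rpow_mul zero_le_two, mul_comm (w : ℝ),
    Real.rpow_mul zero_le_two, h4p, Real.rpow_natCast]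
  exact hreal

/-- Let `p ≥ 5` be prime, `q` a power of `p`, and `n = p^k u` with `k ≥ 1` and
`gcd(u, p) = 1`. Then `W((q^{p^k u} - 1)/(q^u - 1)) ≤ ε(q) · q^{(p^k - 1) u/(2 + log₂ p)}`,
where `ε(q) = 2` if `q = 5` and `ε(q) = 1` otherwise. -/
theorem stmt_18 (p t q k u : ℕ) (hp : p.Prime) (hp5 : 5 ≤ p) (ht : 1 ≤ t) (hq : q = p ^ t)
    (hk : 1 ≤ k) (hu : 1 ≤ u) (hgcd : Nat.gcd u p = 1) :
    (Wnat ((q ^ (p ^ k * u) - 1) / (q ^ u - 1)) : ℝ) ≤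
      (if q = 5 then (2 : ℝ) else 1) *
        (q : ℝ) ^ ((((p ^ k - 1) * u : ℕ) : ℝ) / (2 + Real.logb 2 p)) := by
  have hpq : p ≤ q := hq ▸ Nat.le_self_pow (by omega) p
  have hqQ : q ≤ q ^ u := Nat.le_self_pow (by omega) q
  have hpn : p ≤ p ^ k := Nat.le_self_pow (by omega) p
  have hexp : p - 1 ≤ (p ^ k - 1) * u :=
    (Nat.sub_le_sub_right hpn 1).trans (Nat.le_mul_of_pos_right _ hu)
  have hpow : q ^ (p - 1) ≤ q ^ ((p ^ k - 1) * u) := Nat.pow_le_pow_right (by omega) hexp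
  have hN : (q ^ (p ^ k * u) - 1) / (q ^ u - 1) = ∑ i ∈ Finset.range (p ^ k), (q ^ u) ^ i := by
    rw [Nat.geomSum_eq (by omega), ← pow_mul, mul_comm]
  rw [hN]
  set N := ∑ i ∈ Finset.range (p ^ k), (q ^ u) ^ i with hNdef
  have hNle : 4 * N ≤ 5 * q ^ ((p ^ k - 1) * u) := by
    have := four_mul_geom_sum_le (hp5.trans (hpq.trans hqQ)) (p ^ k - 1)
    rwa [Nat.sub_add_cancel (by omega), ← hNdef, ← pow_mul, mul_comm u] at this
  have hNpos : 0 < N := Finset.sum_pos (fun i _ => pow_pos (by omega) i) (by simp [hp.ne_zero])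
  have hdvd : p ∣ q ^ u := by
    rw [hq]
    exact dvd_pow (dvd_pow_self p (by omega)) (by omega)
  have hprod := pow_mul_factorial_card_le_prod (d := 2 * p) N.primeFactors fun r hr =>
    ⟨(Nat.prime_of_mem_primeFactors hr).one_lt,
      two_mul_dvd_sub_one_of_dvd_geom_sum hp (by omega) hdvd (Nat.prime_of_mem_primeFactors hr)
        (Nat.dvd_of_mem_primeFactors hr)⟩
  replace hprod := hprod.trans (Nat.le_of_dvd hNpos (Nat.prod_primeFactors_dvd N))
  simp only [Wnat, Nat.cast_pow, Nat.cast_ofNat]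
  set w := N.primeFactors.card
  have hlarge : 4 ≤ w → (4 * p) ^ w ≤ q ^ ((p ^ k - 1) * u) := by
    intro hw
    have h1 := Nat.mul_le_mul_left ((2 * p) ^ w) (five_mul_two_pow_le_four_mul_factorial hw)
    have h2 : (4 * p) ^ w = (2 * p) ^ w * 2 ^ w := by
      rw [← mul_pow]
      congr 1
      ring
    nlinarith
  split_ifs with hq5
  · have hp_eq : p = 5 := by omega
    have hmain : (4 * p) ^ (w - 1) ≤ q ^ ((p ^ k - 1) * u) := by
      rcases le_or_gt 4 w with hw | hw
      · exact (Nat.pow_le_pow_right (by omega) (Nat.sub_le w 1)).trans (hlarge hw)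
      · refine le_trans ?_ hpow
        refine (Nat.pow_le_pow_right (by omega) (show w - 1 ≤ 2 by omega)).trans ?_
        rw [hp_eq, hq5]
        norm_num
    calc (2 : ℝ) ^ w ≤ 2 ^ (w - 1 + 1) := pow_le_pow_right₀ one_le_two (by omega)
      _ = 2 * 2 ^ (w - 1) := pow_succ' _ _
      _ ≤ _ := by
        gcongr
        exact two_pow_le_rpow_of_pow_le hp.one_le hmain
  · rw [one_mul]
    refine two_pow_le_rpow_of_pow_le hp.one_le ?_
    rcases le_or_gt 4 w with hw | hw
    · exact hlarge hw
    refine le_trans ?_ hpow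
    refine (Nat.pow_le_pow_right (by omega) (show w ≤ 3 by omega)).trans ?_
    rcases hp5.eq_or_lt with rfl | hp6
    · have ht2 : 2 ≤ t := by
        by_contra hlt
        have : t = 1 := by omega
        exact hq5 (by rw [hq, this, pow_one])
      have h25 : 25 ≤ q := by
        rw [hq]
        exact Nat.pow_le_pow_right (n := 5) (by omega) ht2
      exact le_trans (by norm_num) (Nat.pow_le_pow_left h25 4)
    · have h7 : 7 ≤ p := by
        by_contra hlt
        have : p = 6 := by omega
        rw [this] at hp
        exact absurd hp (by norm_num)
      calc (4 * p) ^ 3 = 64 * p ^ 3 := by ring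
        _ ≤ p ^ 3 * p ^ 3 := by
          gcongr
          exact le_trans (by norm_num) (Nat.pow_le_pow_left h7 3)
        _ = p ^ 6 := by ring
        _ ≤ p ^ (p - 1) := Nat.pow_le_pow_right (by omega) (by omega)
        _ ≤ q ^ (p - 1) := Nat.pow_le_pow_left hpq _
end
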